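/- arXiv:math/0611269 — 4 statements merged into one kernel-verified Lean document; each statement's English description precedes it below -/
import Mathlib

section
/- Let n ≥ 2, let a_0, …, a_{n−1} ∈ ℍ, and let M_n[ℍ] be the companion matrix of A_n(q) = q^n − Σ_{s=0}^{n−1} a_s q^s. If Φ = (φ_1, …, φ_n)ᵀ ∈ ℍⁿ is nonzero and satisfies M_n[ℍ]Φ = Φλ for some λ ∈ ℂ, then q = φ_{n−1} φ_n^{−1} is a zero of the polynomial, i.e. q^n − Σ_{s=0}^{n−1} a_s q^s = 0. -/
open Quaternion Matrix

/-- A sequence in which each entry is the next one times `l` is determined by its last entry. -/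
lemma apply_rev_eq_last_mul_pow {R : Type*} [Monoid R] {n : ℕ} {Φ : Fin (n + 1) → R} {l : R}
    (h : ∀ r : Fin n, Φ r.castSucc = Φ r.succ * l) (k : Fin (n + 1)) :
    Φ k.rev = Φ (Fin.last n) * l ^ (k : ℕ) := by
  induction k using Fin.induction with
  | zero => simp
  | succ i ih =>
    rw [Fin.rev_succ, h, ← Fin.rev_castSucc, ih, Fin.val_succ, pow_succ, mul_assoc,
      Fin.val_castSucc]

/-- **Theorem B.** If `Φ ≠ 0` is a right eigenvector of the companion matrix of the unilateral
quaternionic polynomial `A_n(q) = q^n - ∑_{s=0}^{n-1} a_s q^s` (with complex eigenvalue `λ`),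
then `q = φ_{n-1} φ_n⁻¹` is a zero of the polynomial. -/
theorem stmt_2 (n : ℕ) (hn : 2 ≤ n) (a : Fin n → Quaternion ℝ)
    (M : Matrix (Fin n) (Fin n) (Quaternion ℝ))
    (hM : ∀ r s : Fin n, M r s =
      if (r : ℕ) = 0 then a ⟨n - 1 - (s : ℕ), by omega⟩
      else if (r : ℕ) = (s : ℕ) + 1 then 1 else 0)
    (Φ : Fin n → Quaternion ℝ) (lam : ℂ)
    (hΦ : M.mulVec Φ = fun r => Φ r * (lam : Quaternion ℝ))
    (hΦne : Φ ≠ 0)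
    (q : Quaternion ℝ)
    (hq : q = Φ ⟨n - 2, by omega⟩ * (Φ ⟨n - 1, by omega⟩)⁻¹) :
    q ^ n - ∑ s : Fin n, a s * q ^ (s : ℕ) = 0 := by
  obtain ⟨m, rfl⟩ : ∃ m, n = m + 1 := ⟨n - 1, by omega⟩
  set l : Quaternion ℝ := (lam : Quaternion ℝ)
  have hstep : ∀ r : Fin m, Φ r.castSucc = Φ r.succ * l := fun r => by
    have h := congrFun hΦ r.succ
    rw [Matrix.mulVec, dotProduct, Finset.sum_eq_single r.castSucc] at h
    · simpa [hM] using h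
    · intro s _ hs
      have hne : (r : ℕ) ≠ s := fun e => hs (Fin.ext e.symm)
      simp [hM, hne]
    · simp
  have hrev := apply_rev_eq_last_mul_pow hstep
  set p := Φ (Fin.last m)
  have hp : p ≠ 0 := fun h0 => hΦne <| funext fun k => by
    simpa [h0] using hrev k.rev
  have hqp : q = p * l * p⁻¹ := by
    have h := hrev ⟨1, by omega⟩
    rw [pow_one] at h
    rw [hq, ← h]
    congr 2
  have hpow : ∀ k : ℕ, q ^ k * p = p * l ^ k := fun k => by
    have hs : SemiconjBy p l q := by
      rw [SemiconjBy, hqp, inv_mul_cancel_right₀ hp]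
    exact (hs.pow_right k).eq.symm
  have hfirst : ∑ s : Fin (m + 1), a s * (p * l ^ (s : ℕ)) = p * l ^ (m + 1) := by
    have h := congrFun hΦ 0
    have h0 := hrev (Fin.last m)
    rw [Fin.rev_last, Fin.val_last] at h0
    simp only [h0] at h
    rw [mul_assoc, ← pow_succ] at h
    rw [← h, Matrix.mulVec, dotProduct, ← Equiv.sum_comp Fin.revPerm]
    refine Finset.sum_congr rfl fun s _ => ?_
    rw [← hrev, hM, if_pos (by simp), Fin.revPerm_apply, Fin.rev_rev]
    congr 2
    ext
    simp [Fin.val_rev]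
  refine (mul_eq_zero.mp ?_).resolve_right hp
  simp only [sub_mul, Finset.sum_mul, mul_assoc, hpow, hfirst, sub_self]
end

section
/- Let n ≥ 1, let a_0, …, a_{n−1} ∈ ℍ, and let M_n[ℍ] be the companion matrix of A_n(q) = q^n − Σ_{s=0}^{n−1} a_s q^s. If Φ = (φ_1, …, φ_n)ᵀ ∈ ℍⁿ is nonzero and satisfies M_n[ℍ]Φ = Φλ for some λ ∈ ℂ, then q = φ_n λ φ_n^{−1} is a zero of the polynomial, i.e. q^n − Σ_{s=0}^{n−1} a_s q^s = 0. -/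
open Quaternion Matrix

/-- If `Φ ≠ 0` is a right eigenvector of the companion matrix of the unilateral quaternionic
polynomial `A_n(q) = q^n - ∑_{s=0}^{n-1} a_s q^s` with complex eigenvalue `λ`, then
`q = φ_n λ φ_n⁻¹` is a zero of the polynomial. -/
theorem stmt_3 (n : ℕ) (hn : 1 ≤ n) (a : Fin n → Quaternion ℝ)
    (M : Matrix (Fin n) (Fin n) (Quaternion ℝ))
    (hM : ∀ r s : Fin n, M r s =
      if (r : ℕ) = 0 then a ⟨n - 1 - (s : ℕ), by omega⟩
      else if (r : ℕ) = (s : ℕ) + 1 then 1 else 0)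
    (Φ : Fin n → Quaternion ℝ) (lam : ℂ)
    (hΦ : M.mulVec Φ = fun r => Φ r * (lam : Quaternion ℝ))
    (hΦne : Φ ≠ 0)
    (q : Quaternion ℝ)
    (hq : q = Φ ⟨n - 1, by omega⟩ * (lam : Quaternion ℝ) * (Φ ⟨n - 1, by omega⟩)⁻¹) :
    q ^ n - ∑ s : Fin n, a s * q ^ (s : ℕ) = 0 := by
  generalize (lam : Quaternion ℝ) = μ at hΦ hq
  obtain ⟨m, rfl⟩ : ∃ m, n = m + 1 := ⟨n - 1, by omega⟩
  have last_eq : (⟨m + 1 - 1, by omega⟩ : Fin (m + 1)) = Fin.last m := rfl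
  rw [last_eq] at hq
  have shift (i : Fin m) : Φ i.castSucc = Φ i.succ * μ := by
    have h := congrFun hΦ i.succ
    rw [← h, mulVec, dotProduct, Finset.sum_eq_single i.castSucc]
    · simp [hM]
    · intro s _ hs
      have : (i : ℕ) ≠ s := fun h => hs (Fin.ext h.symm)
      simp [hM, this]
    · simp
  have rev_eq (k : ℕ) (hk : k < m + 1) : Φ (Fin.rev ⟨k, hk⟩) = Φ (Fin.last m) * μ ^ k := by
    induction k with
    | zero => simp [Fin.rev, Fin.last]
    | succ k ih =>
      have h := shift ⟨m - (k + 1), by omega⟩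
      have hcast : Fin.castSucc (⟨m - (k + 1), by omega⟩ : Fin m) = Fin.rev ⟨k + 1, hk⟩ := by
        ext; simp
      have hsucc : Fin.succ (⟨m - (k + 1), by omega⟩ : Fin m) = Fin.rev ⟨k, by omega⟩ := by
        ext; simp; omega
      rw [hcast, hsucc, ih (by omega)] at h
      rw [h, pow_succ, mul_assoc]
  have last_ne : Φ (Fin.last m) ≠ 0 := by
    intro h0
    apply hΦne
    funext r
    have h := rev_eq r.rev r.rev.isLt
    rwa [Fin.eta, Fin.rev_rev, h0, zero_mul] at h
  have semiconj : SemiconjBy (Φ (Fin.last m)) μ q := by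
    rw [SemiconjBy, hq, inv_mul_cancel_right₀ last_ne]
  have first_row : ∑ k : Fin (m + 1), a k * Φ k.rev = Φ (Fin.last m) * μ ^ (m + 1) := by
    have h := congrFun hΦ 0
    have h0 := rev_eq m (by omega)
    have hrev : Fin.rev (⟨m, by omega⟩ : Fin (m + 1)) = 0 := by ext; simp
    rw [hrev] at h0
    rw [pow_succ, ← mul_assoc, ← h0, ← h, mulVec, dotProduct, ← Equiv.sum_comp Fin.revPerm]
    refine Finset.sum_congr rfl fun s _ => ?_
    have hs : (⟨m + 1 - 1 - (s : ℕ), by omega⟩ : Fin (m + 1)) = s.rev := by ext; simp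
    rw [hM, if_pos (Fin.val_zero _), hs, Fin.revPerm_apply, Fin.rev_rev]
  apply (mul_eq_zero_iff_right last_ne).mp
  rw [sub_mul, Finset.sum_mul, ← (semiconj.pow_right (m + 1)).eq, ← first_row, sub_eq_zero]
  refine Finset.sum_congr rfl fun k _ => ?_
  rw [mul_assoc, ← (semiconj.pow_right k).eq, rev_eq k k.isLt]
end

section
/- Let n ≥ 2, let a_0, …, a_{n−1} ∈ ℍ, and let M_n[ℍ] be the companion matrix of A_n(q) = q^n − Σ_{s=0}^{n−1} a_s q^s. If Φ = (φ_1, …, φ_n)ᵀ ∈ ℍⁿ is nonzero and satisfies M_n[ℍ]Φ = Φλ for some λ ∈ ℂ, then the vector Ψ = Φ φ_n^{−1} |φ_n| (componentwise right multiplication) satisfies the privileged right quaternionic eigenvalue equation M_n[ℍ]Ψ = Ψq, where q = φ_{n−1} φ_n^{−1} is a zero of the polynomial. -/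
open Quaternion Matrix

/-- Right multiplication of the vector commutes with the left action of a matrix. -/
lemma mulVec_mul_right {R m n : Type*} [NonUnitalSemiring R] [Fintype n]
    (M : Matrix m n R) (v : n → R) (u : R) :
    M.mulVec (fun s => v s * u) = fun r => M.mulVec v r * u := by
  funext r
  simp only [Matrix.mulVec, dotProduct, Finset.sum_mul, mul_assoc]

/-- The components of a vector with `Φ s = Φ (s + 1) * l` are determined by the last one. -/
lemma eq_last_mul_pow {R : Type*} [Monoid R] {n : ℕ} (Φ : Fin n → R) (l : R)
    (h : ∀ (s : ℕ) (hs : s + 1 < n), Φ ⟨s, by omega⟩ = Φ ⟨s + 1, hs⟩ * l)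
    (k : ℕ) (hk : k < n) :
    Φ ⟨n - 1 - k, by omega⟩ = Φ ⟨n - 1, by omega⟩ * l ^ k := by
  induction k with
  | zero => simp
  | succ k ih =>
    have hs : n - 1 - (k + 1) + 1 = n - 1 - k := by omega
    rw [h (n - 1 - (k + 1)) (by omega), pow_succ, ← mul_assoc, ← ih (by omega)]
    simp only [hs]

/-- Given a nonzero right eigenvector `Φ` of the companion matrix of
`A_n(q) = q^n - ∑_{s=0}^{n-1} a_s q^s` with complex eigenvalue `λ`, the vector
`Ψ = Φ φ_n⁻¹ |φ_n|` satisfies the privileged right quaternionic eigenvalue equation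
`M_n[ℍ] Ψ = Ψ q`, where `q = φ_{n-1} φ_n⁻¹` is a zero of the polynomial. -/
theorem stmt_6 (n : ℕ) (hn : 2 ≤ n) (a : Fin n → Quaternion ℝ)
    (M : Matrix (Fin n) (Fin n) (Quaternion ℝ))
    (hM : ∀ r s : Fin n, M r s =
      if (r : ℕ) = 0 then a ⟨n - 1 - (s : ℕ), by omega⟩
      else if (r : ℕ) = (s : ℕ) + 1 then 1 else 0)
    (Φ : Fin n → Quaternion ℝ) (lam : ℂ)
    (hΦ : M.mulVec Φ = fun r => Φ r * (lam : Quaternion ℝ))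
    (hΦne : Φ ≠ 0)
    (q : Quaternion ℝ)
    (hq : q = Φ ⟨n - 2, by omega⟩ * (Φ ⟨n - 1, by omega⟩)⁻¹)
    (Ψ : Fin n → Quaternion ℝ)
    (hΨ : Ψ = fun (r : Fin n) =>
      Φ r * (Φ ⟨n - 1, by omega⟩)⁻¹ * ((‖Φ ⟨n - 1, by omega⟩‖ : ℝ) : Quaternion ℝ)) :
    (M.mulVec Ψ = fun r => Ψ r * q) ∧ q ^ n - ∑ s : Fin n, a s * q ^ (s : ℕ) = 0 := by
  have hrow : ∀ (s : ℕ) (hs : s + 1 < n),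
      Φ ⟨s, by omega⟩ = Φ ⟨s + 1, hs⟩ * (lam : Quaternion ℝ) := by
    intro s hs
    rw [← congrFun hΦ ⟨s + 1, hs⟩, Matrix.mulVec, dotProduct,
      Finset.sum_eq_single (⟨s, by omega⟩ : Fin n)]
    · simp [hM]
    · intro t _ ht
      have hts : s ≠ (t : ℕ) := fun h => ht (Fin.ext h.symm)
      simp [hM, hts]
    · simp
  have hpow := eq_last_mul_pow Φ (lam : Quaternion ℝ) hrow
  have hrev : ∀ s : Fin n, n - 1 - (n - 1 - (s : ℕ)) = s := fun s => by omega
  have htop := congrFun hΦ ⟨0, by omega⟩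
  have hzero := hpow (n - 1) (by omega)
  have hlast : Φ ⟨n - 1, by omega⟩ ≠ 0 := by
    intro h0
    apply hΦne
    funext s
    have hs := hpow (n - 1 - s) (by omega)
    simpa only [hrev, h0, zero_mul, Fin.eta, Pi.zero_apply] using hs
  simp only [Nat.sub_self] at hzero
  have hsub : Φ ⟨n - 2, by omega⟩ = Φ ⟨n - 1, by omega⟩ * (lam : Quaternion ℝ) := by
    simpa only [Nat.sub_sub, pow_one] using hpow 1 (by omega)
  rw [hsub] at hq
  generalize hφ : Φ ⟨n - 1, by omega⟩ = φ at *
  have hqpow : ∀ k : ℕ, q ^ k = φ * (lam : Quaternion ℝ) ^ k * φ⁻¹ := fun k => by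
    rw [hq]
    exact Units.conj_pow (Units.mk0 φ hlast) (lam : Quaternion ℝ) k
  constructor
  · have hΨ' : Ψ = fun r => Φ r * (φ⁻¹ * ((‖φ‖ : ℝ) : Quaternion ℝ)) := by
      simpa only [mul_assoc] using hΨ
    rw [hΨ', mulVec_mul_right, hΦ]
    funext r
    have hcomm := Quaternion.coe_commutes ‖φ‖ (φ * (lam : Quaternion ℝ) * φ⁻¹)
    simp only [hq, mul_assoc] at hcomm ⊢
    rw [hcomm, inv_mul_cancel_left₀ hlast]
  · have hsum : ∑ s : Fin n, a s * (φ * (lam : Quaternion ℝ) ^ (s : ℕ)) =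
        φ * (lam : Quaternion ℝ) ^ n := by
      rw [hzero, mul_assoc, ← pow_succ, Nat.sub_add_cancel (by omega)] at htop
      rw [← htop, Matrix.mulVec, dotProduct, ← Equiv.sum_comp Fin.revPerm]
      refine Finset.sum_congr rfl fun s _ => ?_
      have hs : n - ((s : ℕ) + 1) = n - 1 - s := by omega
      have hv := hpow (n - 1 - s) (by omega)
      simp only [hrev, hφ] at hv
      simp only [hM, Fin.revPerm_apply, Fin.rev, hs, hv, if_true]
    simp only [hqpow, ← mul_assoc, ← Finset.sum_mul]
    simp only [← mul_assoc] at hsum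
    rw [hsum, sub_self]
end

section
/- Let α_0, α_1, β_1 ∈ ℍ and let 𝓜_2[ℍ] be the generalized companion matrix with rows (α_1, α_0) and (1, β_1). If Φ = (φ_1, φ_2)ᵀ ∈ ℍ² is nonzero and satisfies 𝓜_2[ℍ]Φ = Φλ for some λ ∈ ℂ, then p = φ_1 φ_2^{−1} solves the bilateral quadratic equation, i.e. p² − α_1 p + p β_1 − α_0 = 0. -/
open Quaternion Matrix

/-- If the column `(p b, b)` with `b ≠ 0` is a right eigenvector of the generalized companion
matrix over a domain, then `p` solves the bilateral quadratic equation. -/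
theorem bilateral_quadratic_of_right_eigenvector {R : Type*} [Ring R] [NoZeroDivisors R]
    {α₀ α₁ β₁ p b l : R} (hb : b ≠ 0)
    (h₀ : α₁ * (p * b) + α₀ * b = p * b * l) (h₁ : p * b + β₁ * b = b * l) :
    p ^ 2 - α₁ * p + p * β₁ - α₀ = 0 := by
  refine (mul_eq_zero.mp ?_).resolve_right hb
  calc (p ^ 2 - α₁ * p + p * β₁ - α₀) * b
      = p * (p * b + β₁ * b) - (α₁ * (p * b) + α₀ * b) := by noncomm_ring
    _ = 0 := by rw [h₀, h₁, mul_assoc, sub_self]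

/-- If `Φ ≠ 0` is a right eigenvector (with complex eigenvalue `λ`) of the generalized
companion matrix `𝓜₂[ℍ] = [[α₁, α₀], [1, β₁]]`, then `p = φ₁ φ₂⁻¹` solves the bilateral
quadratic equation `p² - α₁ p + p β₁ - α₀ = 0`. -/
theorem stmt_11 (α₀ α₁ β₁ : Quaternion ℝ)
    (M : Matrix (Fin 2) (Fin 2) (Quaternion ℝ))
    (hM : M = !![α₁, α₀; 1, β₁])
    (Φ : Fin 2 → Quaternion ℝ) (lam : ℂ)
    (hΦ : M.mulVec Φ = fun r => Φ r * (lam : Quaternion ℝ))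
    (hΦne : Φ ≠ 0)
    (p : Quaternion ℝ) (hp : p = Φ 0 * (Φ 1)⁻¹) :
    p ^ 2 - α₁ * p + p * β₁ - α₀ = 0 := by
  subst hM
  have h₀ : α₁ * Φ 0 + α₀ * Φ 1 = Φ 0 * (lam : Quaternion ℝ) := by
    simpa [Matrix.mulVec, dotProduct, Fin.sum_univ_two] using congrFun hΦ 0
  have h₁ : Φ 0 + β₁ * Φ 1 = Φ 1 * (lam : Quaternion ℝ) := by
    simpa [Matrix.mulVec, dotProduct, Fin.sum_univ_two] using congrFun hΦ 1
  have hb : Φ 1 ≠ 0 := by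
    intro hb
    have ha : Φ 0 = 0 := by simpa [hb] using h₁
    exact hΦne (funext (Fin.forall_fin_two.mpr ⟨ha, hb⟩))
  have hpb : Φ 0 = p * Φ 1 := by rw [hp, inv_mul_cancel_right₀ hb]
  rw [hpb] at h₀ h₁
  exact bilateral_quadratic_of_right_eigenvector hb h₀ h₁
end
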